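/- Define g(a,b,c,d) := (6√5 − 10)·(a²b² + 2a²b + 2ab² + a² + b²) + 20·a·b·c·d + 10·a·b·(c² + d²) + (18√5 − 10)·a·b + 6√5·(a + b + c + d) − (20 − 6√5)·(a + b)·(c + d) − (40 − 6√5)·a·b·(c + d) − 10·(c + d)². If a, b, c, d are positive reals with c ≤ 1, d ≤ 1, 1 + a + a·b − c − d ≥ 0, and 1 + b + a·b − c − d ≥ 0, then g(a,b,c,d) ≥ 0, with g(a,b,c,d) = 0 if and only if a = b = (√5 − 1)/2 and c = d = 1. -/

import Mathlib

/-- The polynomial `g` arising from the pentagon circumscription inequality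
after clearing denominators and multiplying by 2. -/
noncomputable def g (a b c d : ℝ) : ℝ :=
  (6 * Real.sqrt 5 - 10) * (a ^ 2 * b ^ 2 + 2 * a ^ 2 * b + 2 * a * b ^ 2 + a ^ 2 + b ^ 2) +
    20 * a * b * c * d + 10 * a * b * (c ^ 2 + d ^ 2) + (18 * Real.sqrt 5 - 10) * a * b +
    6 * Real.sqrt 5 * (a + b + c + d) - (20 - 6 * Real.sqrt 5) * (a + b) * (c + d) -
    (40 - 6 * Real.sqrt 5) * a * b * (c + d) - 10 * (c + d) ^ 2

/-- `g` depends on `c` and `d` only through `q = c + d - 1`, and is a binary quadratic form in `q`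
and `w = (1 + a) * (1 + b) - q` up to the term `10 * (a * b) * q ^ 2`. -/
lemma g_eq_quadratic_form (a b c d w q : ℝ) (hq : q = c + d - 1)
    (hw : w = (1 + a) * (1 + b) - q) :
    g a b c d = (6 * √5 - 10) * w ^ 2 + (18 * √5 - 40) * (w * q) - (40 - 12 * √5) * q ^ 2 +
      10 * (a * b) * q ^ 2 := by
  subst hw hq
  unfold g
  ring

lemma sqrt_five_bounds : 2.236 < √5 ∧ √5 < 2.2361 :=
  ⟨Real.lt_sqrt_of_sq_lt (by norm_num), (Real.sqrt_lt' (by norm_num)).2 (by norm_num)⟩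

/-- Factorization of the quartic that bounds `g` from below, with its root at `(√5 - 1) / 2`. -/
lemma quartic_factorization (x : ℝ) :
    (6 * √5 - 10) + (18 * √5 - 40) * x - (40 - 12 * √5) * x ^ 2 + 10 * x ^ 4 =
      ((√5 - 1) / 2 - x) *
        ((10 - 2 * √5) + (25 - 7 * √5) * x + (5 - 5 * √5) * x ^ 2 - 10 * x ^ 3) := by
  have h5 : √5 ^ 2 = 5 := Real.sq_sqrt (by norm_num)
  linear_combination (1 + 7 / 2 * x + 5 / 2 * x ^ 2) * h5

lemma quartic_cofactor_pos {x : ℝ} (hx : 0 < x) (hx1 : x * (1 + x) ≤ 1) :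
    0 < (10 - 2 * √5) + (25 - 7 * √5) * x + (5 - 5 * √5) * x ^ 2 - 10 * x ^ 3 := by
  obtain ⟨hl, hu⟩ := sqrt_five_bounds
  have hlt : x < 1 := by nlinarith
  have h2 : x ^ 2 ≤ 1 - x := by linarith
  have h3 : x ^ 3 ≤ x * (1 - x) := by nlinarith
  nlinarith [mul_nonneg (sub_nonneg.2 hu.le) hx.le, mul_nonneg (sub_nonneg.2 hu.le) (sq_nonneg x)]

lemma le_golden_of_mul_le {x : ℝ} (hx1 : x * (1 + x) ≤ 1) : x ≤ (√5 - 1) / 2 := by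
  have h : 2 * x + 1 ≤ √5 := Real.le_sqrt_of_sq_le (by nlinarith)
  linarith

lemma g_pos_of_add_le_one {a b c d : ℝ} (ha : 0 < a) (hb : 0 < b) (hc : 0 < c) (hd : 0 < d)
    (hcd : c + d ≤ 1) : 0 < g a b c d := by
  obtain ⟨hl, hu⟩ := sqrt_five_bounds
  rw [g_eq_quadratic_form a b c d _ _ rfl rfl]
  set q := c + d - 1 with hq
  set w := (1 + a) * (1 + b) - q with hw
  have hab : 0 < a * b := mul_pos ha hb
  have hw2 : 0 < w + 2 * q := by nlinarith
  have hw0 : 0 < w := by linarith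
  have hform : 0 < (6 * √5 - 10) * w - (20 - 6 * √5) * q := by nlinarith
  have := mul_pos hw2 hform
  have : 0 ≤ 10 * (a * b) * q ^ 2 := by positivity
  linarith

/-- On the constrained region, `g ≥ 0`, with equality exactly at the parameters of the
affine regular pentagon. -/
theorem g_nonneg (a b c d : ℝ)
    (ha : 0 < a) (hb : 0 < b) (hc : 0 < c) (hd : 0 < d)
    (hc1 : c ≤ 1) (hd1 : d ≤ 1)
    (he : 0 ≤ 1 + a + a * b - c - d) (hf : 0 ≤ 1 + b + a * b - c - d) :
    0 ≤ g a b c d ∧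
      (g a b c d = 0 ↔
        a = (Real.sqrt 5 - 1) / 2 ∧ b = (Real.sqrt 5 - 1) / 2 ∧ c = 1 ∧ d = 1) := by
  have h5 : √5 ^ 2 = 5 := Real.sq_sqrt (by norm_num)
  obtain ⟨hl, hu⟩ := sqrt_five_bounds
  have hroot : a = (√5 - 1) / 2 ∧ b = (√5 - 1) / 2 ∧ c = 1 ∧ d = 1 → g a b c d = 0 := by
    rintro ⟨rfl, rfl, rfl, rfl⟩
    have hφ : ((√5 - 1) / 2) ^ 2 = 1 - (√5 - 1) / 2 := by linear_combination h5 / 4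
    generalize hx : (√5 - 1) / 2 = x at hφ
    have hr : √5 = 2 * x + 1 := by linarith
    unfold g
    rw [hr]
    have h3 : x ^ 3 = 2 * x - 1 := by linear_combination (x - 1) * hφ
    have h4 : x ^ 4 = 2 - 3 * x := by linear_combination (x ^ 2 - x + 2) * hφ
    have h5' : x ^ 5 = 5 * x - 3 := by linear_combination (x ^ 3 - x ^ 2 + 2 * x - 3) * hφ
    ring_nf
    rw [hφ, h3, h4, h5']
    ring
  rcases le_or_gt (c + d) 1 with hcd | hcd
  · have hpos := g_pos_of_add_le_one ha hb hc hd hcd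
    exact ⟨hpos.le, fun h => absurd h hpos.ne', hroot⟩
  have hg := g_eq_quadratic_form a b c d _ _ rfl rfl
  set q := c + d - 1 with hq
  set w := (1 + a) * (1 + b) - q with hw
  have hq0 : 0 < q := by linarith
  have hw1 : 1 + b ≤ w := by linarith
  have hw0 : 0 < w := by linarith
  obtain ⟨x, hx⟩ : ∃ x, q = x * w := ⟨q / w, by field_simp⟩
  have hx0 : 0 < x := pos_of_mul_pos_left (hx ▸ hq0) hw0.le
  have hp : (w - 1) * x ≤ a * b := by
    have h : 0 ≤ (w - 1 - a) * (w - 1 - b) := mul_nonneg (by linarith) (by linarith)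
    have : w * ((w - 1) * x) ≤ w * (a * b) := by
      linear_combination h + (1 - w) * hx
    exact le_of_mul_le_mul_left this hw0
  have hxw : x ≤ w - 1 := by
    have hba : b * (1 + a) ≥ q := by linarith
    have : x * w ≤ (w - 1) * w := by
      nlinarith only [hba, hw1, hx, hw0, he, hb, ha]
    exact le_of_mul_le_mul_right this hw0
  have hq1 : x * w ≤ 1 := by linarith
  have hx1 : x * (1 + x) ≤ 1 :=
    (mul_le_mul_of_nonneg_left (by linarith) hx0.le).trans hq1
  have hxp : x ^ 2 ≤ a * b := by
    linarith [mul_le_mul_of_nonneg_right hxw hx0.le, sq x]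
  have hC := quartic_cofactor_pos hx0 hx1
  have hφ := le_golden_of_mul_le hx1
  have key := quartic_factorization x
  set C := (10 - 2 * √5) + (25 - 7 * √5) * x + (5 - 5 * √5) * x ^ 2 - 10 * x ^ 3
  have hg' : g a b c d = w ^ 2 * (((√5 - 1) / 2 - x) * C) + 10 * q ^ 2 * (a * b - x ^ 2) := by
    rw [hg, ← key, hx]
    ring
  have h1 : 0 ≤ w ^ 2 * (((√5 - 1) / 2 - x) * C) :=
    mul_nonneg (sq_nonneg w) (mul_nonneg (sub_nonneg.2 hφ) hC.le)
  have h2 : 0 ≤ 10 * q ^ 2 * (a * b - x ^ 2) :=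
    mul_nonneg (by positivity) (sub_nonneg.2 hxp)
  refine ⟨by linarith, fun h0 => ?_, hroot⟩
  have hz1 : w ^ 2 * (((√5 - 1) / 2 - x) * C) = 0 := by linarith
  have hz2 : 10 * q ^ 2 * (a * b - x ^ 2) = 0 := by linarith
  have hxφ : x = (√5 - 1) / 2 := by
    have : (√5 - 1) / 2 - x = 0 := by simpa [hw0.ne', hC.ne'] using hz1
    linarith
  have hpx : a * b = x ^ 2 := by
    have : a * b - x ^ 2 = 0 := by simpa [hq0.ne'] using hz2
    linarith
  have hxx : x * (1 + x) = 1 := by rw [hxφ]; linear_combination h5 / 4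
  have hwx : w = 1 + x :=
    le_antisymm (le_of_mul_le_mul_left (by linarith : x * w ≤ x * (1 + x)) hx0) (by linarith)
  have hqe : q = 1 := by rw [hx, hwx, hxx]
  have hsum : a + b = 2 * x := by linarith
  have hax : a = x := by
    have : (a - x) ^ 2 = 0 := by linear_combination a * hsum - hpx
    linarith [pow_eq_zero_iff (two_ne_zero) |>.1 this]
  exact ⟨by linarith, by linarith, by linarith, by linarith⟩
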